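/- For a Markov chain choice model and any r ∈ {2,…,n−1}, the initial distribution λ = (λ_k)_{k∈N₊} is the unique vector x ∈ ℝ^{N₊} satisfying the linear system Σ_{k∈N₊} π(j, S | k) · x_k = π(j, S) for every assortment S ⊆ N with |S| = r and every j ∈ S₊. -/

import Mathlib

open Matrix Filter Finset

/-- The product-by-product submatrix `ρ̃` of the transition matrix
(rows/columns indexed by the products `1,…,n`, i.e. the nonzero states). -/
def subRho {n : ℕ} (rho : Matrix (Fin (n+1)) (Fin (n+1)) ℝ) : Matrix (Fin n) (Fin n) ℝ :=
  Matrix.of fun i j => rho i.succ j.succ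

/-- Markov chain choice model: `lam` is a probability vector on the states `{0,1,…,n}`,
`rho` is row-stochastic, state `0` (no purchase) is absorbing, there are no self-loops on
product states, and the product-by-product submatrix `ρ̃` is irreducible. -/
def IsMCCM {n : ℕ} (lam : Fin (n+1) → ℝ) (rho : Matrix (Fin (n+1)) (Fin (n+1)) ℝ) : Prop :=
  (∀ i, 0 ≤ lam i) ∧ (∑ i, lam i = 1) ∧
  (∀ i j, 0 ≤ rho i j) ∧ (∀ i, ∑ j, rho i j = 1) ∧
  rho 0 0 = 1 ∧
  (∀ i : Fin (n+1), i ≠ 0 → rho i i = 0) ∧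
  (∀ i j : Fin n, ∃ t : ℕ, 1 ≤ t ∧ 0 < (subRho rho ^ t) i j)

/-- `ρ^S`: the transition matrix with every row `i ∈ S` replaced by the `i`-th standard
basis vector, so that all states of `S ∪ {0}` are absorbing. -/
def absorb {n : ℕ} (rho : Matrix (Fin (n+1)) (Fin (n+1)) ℝ) (S : Finset (Fin (n+1))) :
    Matrix (Fin (n+1)) (Fin (n+1)) ℝ :=
  Matrix.of fun i j => if i ∈ S then (if j = i then (1 : ℝ) else 0) else rho i j

/-- The conditional choice probability `π(j, S ∣ i) := lim_{t→∞} ((ρ^S)^t)_{i,j}`. -/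
noncomputable def condProb {n : ℕ} (rho : Matrix (Fin (n+1)) (Fin (n+1)) ℝ)
    (S : Finset (Fin (n+1))) (i j : Fin (n+1)) : ℝ :=
  limUnder atTop fun t : ℕ => (absorb rho S ^ t) i j

/-- The choice probability `π(j, S) := ∑_{k ∈ N₊} λ_k · π(j, S ∣ k)`. -/
noncomputable def choiceProb {n : ℕ} (lam : Fin (n+1) → ℝ)
    (rho : Matrix (Fin (n+1)) (Fin (n+1)) ℝ) (S : Finset (Fin (n+1))) (j : Fin (n+1)) : ℝ :=
  ∑ k, lam k * condProb rho S k j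

/-- A nonnegative vector on the states which vanishes at `0` and at some product and is dominated
by its image under `ρ` is zero. -/
lemma IsMCCM.eq_zero_of_le_vecMul {n : ℕ} {lam : Fin (n+1) → ℝ}
    {rho : Matrix (Fin (n+1)) (Fin (n+1)) ℝ} (h : IsMCCM lam rho) {z : Fin (n+1) → ℝ}
    (hz : ∀ i, 0 ≤ z i) (hz0 : z 0 = 0) {a : Fin (n+1)} (ha : a ≠ 0) (hza : z a = 0)
    (hle : ∀ j, z j ≤ ∑ i, z i * rho i j) : ∀ i, z i = 0 := by
  obtain ⟨-, -, hrho, hsum, -, -, hirr⟩ := h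
  have htot : ∑ j, z j = ∑ j, ∑ i, z i * rho i j := by
    rw [Finset.sum_comm]
    simp [← Finset.mul_sum, hsum]
  have heq : ∀ j, z j = ∑ i, z i * rho i j := fun j =>
    (Finset.sum_eq_sum_iff_of_le fun j _ => hle j).1 htot j (Finset.mem_univ j)
  have hstat : (fun i : Fin n => z i.succ) ᵥ* subRho rho = fun i => z i.succ := by
    ext j
    have := heq j.succ
    rw [Fin.sum_univ_succ, hz0, zero_mul, zero_add] at this
    exact this.symm
  have hpow : ∀ t : ℕ, (fun i : Fin n => z i.succ) ᵥ* (subRho rho ^ t) = fun i => z i.succ := by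
    intro t
    induction t with
    | zero => simp
    | succ t ih => rw [pow_succ, ← Matrix.vecMul_vecMul, ih, hstat]
  have hnn : ∀ (t : ℕ) (i j : Fin n), 0 ≤ (subRho rho ^ t) i j := by
    intro t
    induction t with
    | zero => intro i j; simp only [pow_zero, Matrix.one_apply]; split_ifs <;> norm_num
    | succ t ih =>
      intro i j
      rw [pow_succ, Matrix.mul_apply]
      exact Finset.sum_nonneg fun k _ => mul_nonneg (ih i k) (hrho _ _)
  obtain ⟨b, rfl⟩ := Fin.exists_succ_eq.2 ha
  intro i
  refine Fin.cases hz0 (fun i => ?_) i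
  obtain ⟨t, -, ht⟩ := hirr i b
  have hb : ∑ k : Fin n, z k.succ * (subRho rho ^ t) k b = 0 := (congrFun (hpow t) b).trans hza
  have := (Finset.sum_eq_zero_iff_of_nonneg
    fun k _ => mul_nonneg (hz k.succ) (hnn t k b)).1 hb i (Finset.mem_univ i)
  exact (mul_eq_zero.1 this).resolve_right ht.ne'

/-- Outside a set of states containing `0` and some product, the equation `z - z ρ = d`
can be solved by a vector supported outside that set. -/
lemma IsMCCM.exists_sub_vecMul_eq {n : ℕ} {lam : Fin (n+1) → ℝ}
    {rho : Matrix (Fin (n+1)) (Fin (n+1)) ℝ} (h : IsMCCM lam rho) {A : Finset (Fin (n+1))}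
    (h0 : 0 ∈ A) {a : Fin (n+1)} (ha : a ≠ 0) (haA : a ∈ A) (d : Fin (n+1) → ℝ) :
    ∃ z : Fin (n+1) → ℝ, (∀ i ∈ A, z i = 0) ∧ ∀ j ∉ A, z j - ∑ i, z i * rho i j = d j := by
  let K : Matrix (Fin (n+1)) (Fin (n+1)) ℝ := Matrix.of fun i j => if j ∈ A then 0 else rho i j
  have happ : ∀ (z : Fin (n+1) → ℝ) (j : Fin (n+1)),
      (z ᵥ* (1 - K)) j = z j - if j ∈ A then 0 else ∑ i, z i * rho i j := by
    intro z j
    rw [Matrix.vecMul_sub, Matrix.vecMul_one, Pi.sub_apply]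
    congr 1
    by_cases hj : j ∈ A <;> simp [Matrix.vecMul, dotProduct, K, hj]
  have hinj : Function.Injective (1 - K).vecMulLinear := by
    rw [injective_iff_map_eq_zero]
    intro z hz
    have hz' : ∀ j, z j = if j ∈ A then 0 else ∑ i, z i * rho i j := fun j =>
      sub_eq_zero.1 ((happ z j).symm.trans (congrFun hz j))
    have hA : ∀ j ∈ A, z j = 0 := fun j hj => by rw [hz' j, if_pos hj]
    have hrho := h.2.2.1
    ext i
    refine abs_eq_zero.1 (h.eq_zero_of_le_vecMul (z := fun i => |z i|) (fun i => abs_nonneg _)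
      (by simp [hA 0 h0]) ha (by simp [hA a haA]) (fun j => ?_) i)
    by_cases hj : j ∈ A
    · simp only [hA j hj, abs_zero]
      exact Finset.sum_nonneg fun i _ => mul_nonneg (abs_nonneg _) (hrho i j)
    · have := hz' j
      rw [if_neg hj] at this
      calc |z j| = |∑ i, z i * rho i j| := by rw [← this]
        _ ≤ ∑ i, |z i * rho i j| := Finset.abs_sum_le_sum_abs _ _
        _ = ∑ i, |z i| * rho i j := by simp only [abs_mul, abs_of_nonneg (hrho _ _)]
  obtain ⟨z, hz⟩ := LinearMap.surjective_of_injective hinj fun j => if j ∈ A then 0 else d j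
  have hz' : ∀ j, (z j - if j ∈ A then 0 else ∑ i, z i * rho i j) = if j ∈ A then 0 else d j :=
    fun j => (happ z j).symm.trans (congrFun hz j)
  refine ⟨z, fun i hi => ?_, fun j hj => ?_⟩
  · simpa [hi] using hz' i
  · simpa [hj] using hz' j

lemma IsMCCM.absorb_mem_rowStochastic {n : ℕ} {lam : Fin (n+1) → ℝ}
    {rho : Matrix (Fin (n+1)) (Fin (n+1)) ℝ} (h : IsMCCM lam rho) (S : Finset (Fin (n+1))) :
    absorb rho S ∈ Matrix.rowStochastic ℝ (Fin (n+1)) := by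
  obtain ⟨-, -, hnn, hsum, -⟩ := h
  refine Matrix.mem_rowStochastic_iff_sum.2 ⟨fun i j => ?_, fun i => ?_⟩
  · simp only [absorb, Matrix.of_apply]
    split_ifs
    exacts [zero_le_one, le_rfl, hnn i j]
  · by_cases hi : i ∈ S <;> simp [absorb, hi, hsum]

lemma IsMCCM.absorb_apply_of_mem {n : ℕ} {lam : Fin (n+1) → ℝ}
    {rho : Matrix (Fin (n+1)) (Fin (n+1)) ℝ} (h : IsMCCM lam rho) {S : Finset (Fin (n+1))}
    {i : Fin (n+1)} (hi : i ∈ insert 0 S) (j : Fin (n+1)) :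
    absorb rho S i j = if i = j then 1 else 0 := by
  obtain ⟨-, -, hnn, hsum, h00, -⟩ := h
  by_cases hS : i ∈ S
  · simp [absorb, hS, eq_comm]
  · obtain rfl : i = 0 := (Finset.mem_insert.1 hi).resolve_right hS
    simp only [absorb, Matrix.of_apply, if_neg hS]
    split_ifs with hj
    · rw [← hj, h00]
    · have hs := hsum 0
      rw [Fin.sum_univ_succ, h00, add_eq_left] at hs
      obtain ⟨k, rfl⟩ := Fin.exists_succ_eq.2 (Ne.symm hj)
      exact (Finset.sum_eq_zero_iff_of_nonneg fun k _ => hnn 0 _).1 hs k (Finset.mem_univ k)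

lemma IsMCCM.tendsto_condProb {n : ℕ} {lam : Fin (n+1) → ℝ}
    {rho : Matrix (Fin (n+1)) (Fin (n+1)) ℝ} (h : IsMCCM lam rho) {S : Finset (Fin (n+1))}
    {j : Fin (n+1)} (hj : j ∈ insert 0 S) (i : Fin (n+1)) :
    Tendsto (fun t : ℕ => (absorb rho S ^ t) i j) atTop (nhds (condProb rho S i j)) := by
  have hmem : ∀ t : ℕ, absorb rho S ^ t ∈ Matrix.rowStochastic ℝ (Fin (n+1)) := fun t =>
    pow_mem (h.absorb_mem_rowStochastic S) t
  have hnn := fun t => (Matrix.mem_rowStochastic_iff_sum.1 (hmem t)).1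
  have hmono : Monotone fun t : ℕ => (absorb rho S ^ t) i j := by
    refine monotone_nat_of_le_succ fun t => ?_
    rw [pow_succ, Matrix.mul_apply]
    calc (absorb rho S ^ t) i j = (absorb rho S ^ t) i j * absorb rho S j j := by
          rw [h.absorb_apply_of_mem hj, if_pos rfl, mul_one]
      _ ≤ _ := Finset.single_le_sum (f := fun k => (absorb rho S ^ t) i k * absorb rho S k j)
          (fun k _ => mul_nonneg (hnn t i k) (by simpa using hnn 1 k j)) (Finset.mem_univ j)
  have hbdd : BddAbove (Set.range fun t : ℕ => (absorb rho S ^ t) i j) := by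
    refine ⟨1, ?_⟩
    rintro _ ⟨t, rfl⟩
    rw [← (Matrix.mem_rowStochastic_iff_sum.1 (hmem t)).2 i]
    exact Finset.single_le_sum (fun k _ => hnn t i k) (Finset.mem_univ j)
  exact tendsto_nhds_limUnder ⟨_, tendsto_atTop_ciSup hmono hbdd⟩

lemma IsMCCM.sum_absorb_mul_condProb {n : ℕ} {lam : Fin (n+1) → ℝ}
    {rho : Matrix (Fin (n+1)) (Fin (n+1)) ℝ} (h : IsMCCM lam rho) {S : Finset (Fin (n+1))}
    {j : Fin (n+1)} (hj : j ∈ insert 0 S) (i : Fin (n+1)) :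
    ∑ k, absorb rho S i k * condProb rho S k j = condProb rho S i j := by
  refine tendsto_nhds_unique (f := fun t : ℕ => (absorb rho S ^ (t + 1)) i j) (l := atTop) ?_
    ((tendsto_add_atTop_iff_nat 1).2 (h.tendsto_condProb hj i))
  simp only [pow_succ', Matrix.mul_apply]
  exact tendsto_finsetSum _ fun k _ => (h.tendsto_condProb hj k).const_mul _

lemma IsMCCM.condProb_of_mem {n : ℕ} {lam : Fin (n+1) → ℝ}
    {rho : Matrix (Fin (n+1)) (Fin (n+1)) ℝ} (h : IsMCCM lam rho) {S : Finset (Fin (n+1))}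
    {i j : Fin (n+1)} (hi : i ∈ insert 0 S) (hj : j ∈ insert 0 S) :
    condProb rho S i j = if i = j then 1 else 0 := by
  have hpow : ∀ t : ℕ, (absorb rho S ^ t) i j = if i = j then 1 else 0 := by
    intro t
    induction t with
    | zero => simp [Matrix.one_apply]
    | succ t ih => rw [pow_succ', Matrix.mul_apply]; simp [h.absorb_apply_of_mem hi, ih]
  refine tendsto_nhds_unique (h.tendsto_condProb hj i) ?_
  simp only [hpow]
  exact tendsto_const_nhds

/-- A vector `d` annihilated by the conditional choice probabilities of a nonempty assortment `S`
has the form `z - z ρ` with `z` supported outside `S₊`. -/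
lemma IsMCCM.exists_potential {n : ℕ} {lam : Fin (n+1) → ℝ}
    {rho : Matrix (Fin (n+1)) (Fin (n+1)) ℝ} (h : IsMCCM lam rho) {S : Finset (Fin (n+1))}
    (h0 : 0 ∉ S) (hS : S.Nonempty) {d : Fin (n+1) → ℝ}
    (hd : ∀ j ∈ insert 0 S, ∑ k, d k * condProb rho S k j = 0) :
    ∃ z : Fin (n+1) → ℝ, (∀ i ∈ insert 0 S, z i = 0) ∧
      ∀ j, d j = z j - ∑ i, z i * rho i j := by
  obtain ⟨a, ha⟩ := hS
  obtain ⟨z, hz, hzd⟩ := h.exists_sub_vecMul_eq (Finset.mem_insert_self 0 S)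
    (ne_of_mem_of_not_mem ha h0) (Finset.mem_insert_of_mem ha) d
  refine ⟨z, hz, fun j => ?_⟩
  by_cases hj : j ∈ insert 0 S
  swap
  · exact (hzd j hj).symm
  have habs : ∀ i k, z i * rho i k = z i * absorb rho S i k := by
    intro i k
    by_cases hi : i ∈ S
    · simp [hz i (Finset.mem_insert_of_mem hi)]
    · simp [absorb, hi]
  have hker : ∑ k, (z k - ∑ i, z i * rho i k) * condProb rho S k j = 0 := by
    simp only [habs, sub_mul, Finset.sum_sub_distrib, Finset.sum_mul]
    rw [Finset.sum_comm]
    simp [mul_assoc, ← Finset.mul_sum, h.sum_absorb_mul_condProb hj]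
  have hdiff : ∑ k, (d k - (z k - ∑ i, z i * rho i k)) * condProb rho S k j = 0 := by
    simp only [sub_mul (d _), Finset.sum_sub_distrib, hd j hj, hker, sub_zero]
  rw [Finset.sum_eq_single_of_mem j (Finset.mem_univ j), h.condProb_of_mem hj hj, if_pos rfl,
    mul_one, sub_eq_zero] at hdiff
  · exact hdiff
  · intro k _ hkj
    by_cases hk : k ∈ insert 0 S
    · rw [h.condProb_of_mem hk hj, if_neg hkj, mul_zero]
    · rw [hzd k hk, sub_self, zero_mul]

/-- The vector `z - z ρ` determines `z` among the vectors vanishing at `0` and at a fixed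
product. -/
lemma IsMCCM.potential_unique {n : ℕ} {lam : Fin (n+1) → ℝ}
    {rho : Matrix (Fin (n+1)) (Fin (n+1)) ℝ} (h : IsMCCM lam rho) {z w : Fin (n+1) → ℝ}
    (hz0 : z 0 = 0) (hw0 : w 0 = 0) {a : Fin (n+1)} (ha : a ≠ 0) (hza : z a = 0) (hwa : w a = 0)
    (hzw : ∀ j, z j - ∑ i, z i * rho i j = w j - ∑ i, w i * rho i j) (i : Fin (n+1)) :
    z i = w i := by
  have hrho := h.2.2.1
  refine sub_eq_zero.1 (abs_eq_zero.1 (h.eq_zero_of_le_vecMul (z := fun i => |z i - w i|)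
    (fun i => abs_nonneg _) (by simp [hz0, hw0]) ha (by simp [hza, hwa]) (fun j => ?_) i))
  calc |z j - w j| = |∑ i, (z i - w i) * rho i j| := by
        congr 1
        simp only [sub_mul, Finset.sum_sub_distrib]
        linarith [hzw j]
    _ ≤ ∑ i, |(z i - w i) * rho i j| := Finset.abs_sum_le_sum_abs _ _
    _ = ∑ i, |z i - w i| * rho i j := by simp only [abs_mul, abs_of_nonneg (hrho _ _)]

/-- For any `r ∈ {2,…,n−1}`, the initial distribution `λ` is the unique
vector `x ∈ ℝ^{N₊}` satisfying `∑_{k ∈ N₊} π(j, S ∣ k) · x_k = π(j, S)` for every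
assortment `S ⊆ N` with `|S| = r` and every `j ∈ S₊`. -/
theorem mccm_lambda_unique_solution {n : ℕ} (hn : 2 ≤ n)
    (lam : Fin (n+1) → ℝ) (rho : Matrix (Fin (n+1)) (Fin (n+1)) ℝ)
    (h : IsMCCM lam rho)
    (r : ℕ) (hr : 2 ≤ r) (hrn : r ≤ n - 1) :
    ∀ x : Fin (n+1) → ℝ,
      (∀ S : Finset (Fin (n+1)), (0 : Fin (n+1)) ∉ S → S.card = r →
        ∀ j ∈ insert (0 : Fin (n+1)) S,
          ∑ k, condProb rho S k j * x k = choiceProb lam rho S j) ↔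
      x = lam := by
  intro x
  constructor
  swap
  · rintro rfl S - - j -
    exact Finset.sum_congr rfl fun k _ => mul_comm _ _
  intro hx
  have hpot : ∀ S : Finset (Fin (n+1)), 0 ∉ S → S.card = r →
      ∃ z : Fin (n+1) → ℝ, (∀ i ∈ insert 0 S, z i = 0) ∧
        ∀ j, x j - lam j = z j - ∑ i, z i * rho i j := by
    intro S h0 hS
    refine h.exists_potential h0 (Finset.card_pos.1 (by omega)) fun j hj => ?_
    have := hx S h0 hS j hj
    simp only [choiceProb, mul_comm (condProb _ _ _ _)] at this
    simp only [sub_mul, Finset.sum_sub_distrib, this, sub_self]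
  obtain ⟨S, hSsub, hScard⟩ := Finset.exists_subset_card_eq
    (s := Finset.univ.erase (0 : Fin (n+1))) (n := r) (by simp; omega)
  have h0 : (0 : Fin (n+1)) ∉ S := fun hmem => by simpa using hSsub hmem
  obtain ⟨z, hz, hzd⟩ := hpot S h0 hScard
  have hzero : ∀ k, z k = 0 := by
    intro k
    by_cases hk : k ∈ insert 0 S
    · exact hz k hk
    obtain ⟨hk0, hkS⟩ := not_or.1 (mt Finset.mem_insert.2 hk)
    obtain ⟨a, ha, b, hb, hab⟩ := Finset.one_lt_card.1 (by omega : 1 < S.card)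
    obtain ⟨w, hw, hwd⟩ := hpot (insert k (S.erase a))
      (by simp [Ne.symm hk0, h0])
      (by rw [Finset.card_insert_of_notMem (by simp [hkS]), Finset.card_erase_of_mem ha]; omega)
    rw [h.potential_unique (hz 0 (by simp)) (hw 0 (by simp)) (ne_of_mem_of_not_mem hb h0)
      (hz b (by simp [hb])) (hw b (by simp [hb, Ne.symm hab]))
      (fun j => (hzd j).symm.trans (hwd j)) k]
    exact hw k (by simp)
  ext j
  exact sub_eq_zero.1 (by simp [hzd j, hzero])
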